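/- arXiv:1403.7776 — 4 statements merged into one kernel-verified Lean document; each statement's English description precedes it below -/
import Mathlib

section
/- Let ε be a splitting on an open set U ⊆ ℝⁿ. Then the groupoid curvature R vanishes identically on U × U if and only if for every pair (p,q) ∈ U × U there exist an open neighborhood W ⊆ U of p and a smooth map f : W → U with f(p) = q such that ∂f^i(x)/∂x^j = ε^i_j(x, f(x)) for all x ∈ W and all indices i, j. -/
noncomputable section

open Set

/-- The `j`-th coordinate partial derivative of a real-valued function on `ℝⁿ`. -/
noncomputable def pd {n : ℕ} (j : Fin n) (f : (Fin n → ℝ) → ℝ) (x : Fin n → ℝ) : ℝ :=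
  fderiv ℝ f x (Pi.single j 1)

/-- A splitting `ε` on `U`: a smooth groupoid homomorphism `U × U → GL(n,ℝ)`
satisfying `ε(z,y)ε(x,z) = ε(x,y)` and `ε(x,x) = id`. -/
structure IsSplitting {n : ℕ} (U : Set (Fin n → ℝ))
    (eps : (Fin n → ℝ) → (Fin n → ℝ) → Fin n → Fin n → ℝ) : Prop where
  smooth : ∀ i j : Fin n, ContDiffOn ℝ (⊤ : ℕ∞)
    (fun p : (Fin n → ℝ) × (Fin n → ℝ) => eps p.1 p.2 i j) (U ×ˢ U)
  comp : ∀ x ∈ U, ∀ y ∈ U, ∀ z ∈ U, ∀ i j : Fin n,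
    (∑ a, eps z y i a * eps x z a j) = eps x y i j
  refl : ∀ x ∈ U, ∀ i j : Fin n, eps x x i j = if i = j then (1 : ℝ) else 0

/-- `Γ^i_{jk}(x) = (∂ε^i_k(x,y)/∂y^j)|_{y=x}`. -/
noncomputable def Gam {n : ℕ} (eps : (Fin n → ℝ) → (Fin n → ℝ) → Fin n → Fin n → ℝ)
    (i j k : Fin n) (x : Fin n → ℝ) : ℝ :=
  pd j (fun y => eps x y i k) x

/-- The groupoid curvature `R^i_{jk}(x,y)`. -/
noncomputable def Rg {n : ℕ} (eps : (Fin n → ℝ) → (Fin n → ℝ) → Fin n → Fin n → ℝ)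
    (i j k : Fin n) (x y : Fin n → ℝ) : ℝ :=
  pd j (fun x' => eps x' y i k) x + ∑ a, pd a (fun y' => eps x y' i k) y * eps x y a j
    - pd k (fun x' => eps x' y i j) x - ∑ a, pd a (fun y' => eps x y' i j) y * eps x y a k

/-- The algebroid curvature `𝔯^i_{jk,r}(x)`. -/
noncomputable def ra {n : ℕ} (eps : (Fin n → ℝ) → (Fin n → ℝ) → Fin n → Fin n → ℝ)
    (i j k r : Fin n) (x : Fin n → ℝ) : ℝ :=
  pd j (Gam eps i r k) x + ∑ a, Gam eps a r j x * Gam eps i a k x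
    - pd k (Gam eps i r j) x - ∑ a, Gam eps a r k x * Gam eps i a j x

/-- The torsion `T^i_{jk} = Γ^i_{jk} − Γ^i_{kj}`. -/
noncomputable def Tor {n : ℕ} (eps : (Fin n → ℝ) → (Fin n → ℝ) → Fin n → Fin n → ℝ)
    (i j k : Fin n) (x : Fin n → ℝ) : ℝ :=
  Gam eps i j k x - Gam eps i k j x

/-- A vector field `ξ` is `ε`-parallel if `ξ^i(y) = ε^i_a(x,y) ξ^a(x)` for all `x, y ∈ U`. -/
def EpsParallelVF {n : ℕ} (U : Set (Fin n → ℝ))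
    (eps : (Fin n → ℝ) → (Fin n → ℝ) → Fin n → Fin n → ℝ)
    (ξ : (Fin n → ℝ) → Fin n → ℝ) : Prop :=
  ∀ x ∈ U, ∀ y ∈ U, ∀ i, ξ y i = ∑ a, eps x y i a * ξ x a

open Filter Topology NNReal Metric

theorem IsPicardLindelof.exists_hasDerivWithinAt_mem_closedBall
    {E : Type*} [NormedAddCommGroup E] [NormedSpace ℝ E] [CompleteSpace E]
    {f : ℝ → E → E} {tmin tmax : ℝ} {t₀ : Icc tmin tmax} {x₀ x : E} {a r L K : ℝ≥0}
    (hf : IsPicardLindelof f t₀ x₀ a r L K) (hx : x ∈ closedBall x₀ r) :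
    ∃ α : ℝ → E, α t₀ = x ∧ ∀ t ∈ Icc tmin tmax,
      α t ∈ closedBall x₀ a ∧ HasDerivWithinAt α (f t (α t)) (Icc tmin tmax) t := by
  obtain ⟨α, hα⟩ := ODE.FunSpace.exists_isFixedPt_next hf hx
  refine ⟨α.compProj, by rw [ODE.FunSpace.compProj_val, ← hα, ODE.FunSpace.next_apply₀],
    fun t ht ↦ ⟨α.compProj_mem_closedBall hf.mul_max_le, ?_⟩⟩
  apply ODE.hasDerivWithinAt_picard_Icc t₀.2 hf.continuousOn_uncurry
    α.continuous_compProj.continuousOn (fun _ _ ↦ α.compProj_mem_closedBall hf.mul_max_le)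
    x ht |>.congr_of_mem _ ht
  intro t' ht'
  nth_rw 1 [← hα]
  rw [ODE.FunSpace.compProj_of_mem ht', ODE.FunSpace.next_apply]

section Frobenius

variable {E G : Type*} [NormedAddCommGroup E] [NormedSpace ℝ E]
  [NormedAddCommGroup G] [NormedSpace ℝ G]
  {F : E × G → E →L[ℝ] G} {p v w : E} {q : G} {r : ℝ} {M K : ℝ≥0}

/-- Along every short enough segment issuing from `p`, the total differential equation
`df = F (x, f)` restricts to an ordinary differential equation solvable up to time `1`. -/
lemma exists_segment_solution [CompleteSpace G] (hr : 0 ≤ r)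
    (hK : LipschitzOnWith K F (closedBall (p, q) r))
    (hM : ∀ z ∈ closedBall (p, q) r, ‖F z‖ ≤ M) (hv : ‖v‖ ≤ r) (hMv : M * ‖v‖ ≤ r) :
    ∃ y : ℝ → G, y 0 = q ∧ ∀ t ∈ Icc (0 : ℝ) 1, y t ∈ closedBall q r ∧
      HasDerivWithinAt y (F (p + t • v, y t) v) (Icc 0 1) t := by
  lift r to ℝ≥0 using hr
  have hmem : ∀ t ∈ Icc (0 : ℝ) 1, ∀ y ∈ closedBall q r,
      (p + t • v, y) ∈ closedBall (p, q) r := by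
    intro t ht y hy
    rw [← closedBall_prod_same]
    refine ⟨?_, hy⟩
    rw [mem_closedBall, dist_self_add_left, norm_smul, Real.norm_of_nonneg ht.1]
    nlinarith [norm_nonneg v, ht.2]
  have hPL : IsPicardLindelof (fun t y ↦ F (p + t • v, y) v) (tmin := 0) (tmax := 1)
      ⟨0, by simp⟩ q r 0 (M * ‖v‖₊) (K * ‖v‖₊) := by
    refine ⟨fun t ht ↦ ?_, fun y hy ↦ ?_, fun t ht y hy ↦ ?_, ?_⟩
    · refine LipschitzOnWith.of_dist_le_mul fun y hy y' hy' ↦ ?_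
      have := hK.dist_le_mul _ (hmem t ht y hy) _ (hmem t ht y' hy')
      rw [dist_eq_norm, ← sub_apply]
      refine (ContinuousLinearMap.le_opNorm _ _).trans ?_
      rw [← dist_eq_norm]
      have h2 : dist (p + t • v, y) (p + t • v, y') = dist y y' := by simp [Prod.dist_eq]
      rw [h2] at this
      rw [NNReal.coe_mul, coe_nnnorm, mul_right_comm]
      gcongr
    · have h := hK.continuousOn.comp (f := fun t : ℝ ↦ (p + t • v, y)) (by fun_prop)
        (fun t ht ↦ hmem t ht y hy)
      exact h.clm_apply continuousOn_const
    · refine (ContinuousLinearMap.le_opNorm _ _).trans ?_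
      rw [NNReal.coe_mul, coe_nnnorm]
      gcongr
      exact hM _ (hmem t ht y hy)
    · simpa using hMv
  exact hPL.exists_hasDerivWithinAt_mem_closedBall (by simp)

/-- Solutions along neighbouring segments differ to first order by `F`. -/
lemma norm_segment_solution_sub_le
    (hF : ∀ z ∈ closedBall (p, q) (2 * r), DifferentiableAt ℝ F z)
    (hK : LipschitzOnWith K F (closedBall (p, q) (2 * r)))
    (hK' : LipschitzOnWith K (fderiv ℝ F) (closedBall (p, q) (2 * r)))
    (hM : ∀ z ∈ closedBall (p, q) (2 * r), ‖F z‖ ≤ M)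
    (hM' : ∀ z ∈ closedBall (p, q) (2 * r), ‖fderiv ℝ F z‖ ≤ M)
    (hint : ∀ z ∈ closedBall (p, q) (2 * r), ∀ v w : E,
      fderiv ℝ F z (v, F z v) w = fderiv ℝ F z (w, F z w) v)
    (hM1 : 1 ≤ M) (hK0 : 0 < K)
    (hv : ‖v‖ ≤ r) (hvw : ‖v + w‖ ≤ r) (hvw1 : ‖v + w‖ ≤ 1) (hw : M * ‖w‖ ≤ r)
    {y y' : ℝ → G} (hy0 : y 0 = q) (hy0' : y' 0 = q)
    (hy : ∀ t ∈ Icc (0 : ℝ) 1, y t ∈ closedBall q r ∧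
      HasDerivWithinAt y (F (p + t • v, y t) v) (Icc 0 1) t)
    (hy' : ∀ t ∈ Icc (0 : ℝ) 1, y' t ∈ closedBall q r ∧
      HasDerivWithinAt y' (F (p + t • (v + w), y' t) (v + w)) (Icc 0 1) t) :
    ‖y' 1 - y 1 - F (p + v, y 1) w‖ ≤
      (M * M + K * (M * M)) / K * (Real.exp K - 1) * ‖w‖ ^ 2 := by
  have hr : 0 ≤ r := (norm_nonneg v).trans hv
  have hmem : ∀ u : E, ‖u‖ ≤ r → ∀ t ∈ Icc (0 : ℝ) 1, ∀ y ∈ closedBall q (2 * r),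
      (p + t • u, y) ∈ closedBall (p, q) (2 * r) := by
    intro u hu t ht y hy
    rw [← closedBall_prod_same]
    refine ⟨?_, hy⟩
    rw [mem_closedBall, dist_self_add_left, norm_smul, Real.norm_of_nonneg ht.1]
    nlinarith [norm_nonneg u, ht.2]
  have hsub : closedBall q r ⊆ closedBall q (2 * r) := closedBall_subset_closedBall (by linarith)
  have hIci : ∀ t ∈ Ico (0 : ℝ) 1, Icc (0 : ℝ) 1 ∈ 𝓝[≥] t := fun t ht ↦
    mem_of_superset (Icc_mem_nhdsGE ht.2) (Icc_subset_Icc_left ht.1)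
  set z : ℝ → G := fun t ↦ y t + t • F (p + t • v, y t) w with hz
  have hzd : ∀ t ∈ Icc (0 : ℝ) 1, HasDerivWithinAt z
      (F (p + t • v, y t) (v + w) +
        t • fderiv ℝ F (p + t • v, y t) (w, F (p + t • v, y t) w) v) (Icc 0 1) t := by
    intro t ht
    have hB := hmem v hv t ht _ (hsub (hy t ht).1)
    have h1 : HasDerivWithinAt (fun t : ℝ ↦ (p + t • v, y t)) (v, F (p + t • v, y t) v)
        (Icc 0 1) t := by
      refine HasDerivWithinAt.prodMk ?_ (hy t ht).2
      simpa using ((hasDerivWithinAt_id t (Icc 0 1)).smul_const v).const_add p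
    have h2 := (hF _ hB).hasFDerivAt.comp_hasDerivWithinAt t h1
    have h3 := h2.clm_apply (hasDerivWithinAt_const t (Icc 0 1) w)
    have h4 := (hy t ht).2.add ((hasDerivWithinAt_id t (Icc 0 1)).smul h3)
    refine h4.congr_deriv ?_
    simp [hint _ hB v w]
    abel
  have hzmem : ∀ t ∈ Icc (0 : ℝ) 1, z t ∈ closedBall q (2 * r) ∧
      ‖t • F (p + t • v, y t) w‖ ≤ M * ‖w‖ := by
    intro t ht
    have hB := hmem v hv t ht _ (hsub (hy t ht).1)
    have h1 : ‖t • F (p + t • v, y t) w‖ ≤ M * ‖w‖ := by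
      rw [norm_smul, Real.norm_of_nonneg ht.1]
      have h2 : ‖F (p + t • v, y t) w‖ ≤ M * ‖w‖ :=
        (ContinuousLinearMap.le_opNorm _ _).trans (by gcongr; exact hM _ hB)
      nlinarith [norm_nonneg (F (p + t • v, y t) w), ht.1, ht.2]
    refine ⟨?_, h1⟩
    have h3 := mem_closedBall_iff_norm.1 (hy t ht).1
    rw [mem_closedBall_iff_norm]
    calc ‖z t - q‖ = ‖(y t - q) + t • F (p + t • v, y t) w‖ := by simp only [hz, add_sub_right_comm]
      _ ≤ _ := norm_add_le _ _
      _ ≤ 2 * r := by linarith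
  have key := dist_le_of_approx_trajectories_ODE_of_mem (a := 0) (b := 1)
    (v := fun t y ↦ F (p + t • (v + w), y) (v + w)) (s := fun _ ↦ closedBall q (2 * r))
    (K := K) (f := y') (g := z) (δ := 0) (εf := 0)
    (εg := (M * M + K * (M * M)) * ‖w‖ ^ 2)
    (f' := fun t ↦ F (p + t • (v + w), y' t) (v + w))
    (g' := fun t ↦ F (p + t • v, y t) (v + w) +
        t • fderiv ℝ F (p + t • v, y t) (w, F (p + t • v, y t) w) v)
    ?_ (fun t ht ↦ (hy' t ht).2.continuousWithinAt)
    (fun t ht ↦ (hy' t (Ico_subset_Icc_self ht)).2.mono_of_mem_nhdsWithin (hIci t ht))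
    (fun t ht ↦ by simp) (fun t ht ↦ hsub (hy' t (Ico_subset_Icc_self ht)).1)
    (fun t ht ↦ (hzd t ht).continuousWithinAt)
    (fun t ht ↦ (hzd t (Ico_subset_Icc_self ht)).mono_of_mem_nhdsWithin (hIci t ht))
    ?_ (fun t ht ↦ (hzmem t (Ico_subset_Icc_self ht)).1) (by simp [hz, hy0, hy0'])
    1 (by simp)
  · rw [gronwallBound_of_K_ne_0 (by exact_mod_cast hK0.ne'), dist_eq_norm] at key
    simp only [hz, one_smul, zero_mul, zero_add, sub_zero, mul_one] at key
    rw [← sub_sub] at key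
    refine key.trans (le_of_eq ?_)
    ring
  · intro t ht
    refine LipschitzOnWith.of_dist_le_mul fun y hy y' hy' ↦ ?_
    have ht' := Ico_subset_Icc_self ht
    have := hK.dist_le_mul _ (hmem _ hvw t ht' y hy) _ (hmem _ hvw t ht' y' hy')
    have h2 : dist (p + t • (v + w), y) (p + t • (v + w), y') = dist y y' := by
      simp [Prod.dist_eq]
    rw [h2] at this
    rw [dist_eq_norm, ← sub_apply]
    refine (ContinuousLinearMap.le_opNorm _ _).trans ?_
    rw [← dist_eq_norm]
    exact (mul_le_of_le_one_right dist_nonneg hvw1).trans this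
  · intro t ht
    have ht' := Ico_subset_Icc_self ht
    have hB := hmem v hv t ht' _ (hsub (hy t ht').1)
    have hB' := hmem _ hvw t ht' _ (hzmem t ht').1
    set ζ := (p + t • v, y t) with hζ
    set h : E × G := (t • w, t • F ζ w) with hh
    have hζh : (p + t • (v + w), z t) = ζ + h := by
      rw [hζ, hh, Prod.mk_add_mk, smul_add, add_assoc]
    have hhn : ‖h‖ ≤ M * ‖w‖ := by
      refine max_le ?_ (hzmem t ht').2
      rw [norm_smul, Real.norm_of_nonneg ht.1]
      have : (1 : ℝ) ≤ M := by exact_mod_cast hM1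
      exact mul_le_mul (ht.2.le.trans this) le_rfl (norm_nonneg _) M.2
    rw [hζh] at hB'
    have hrem : ‖F (ζ + h) - F ζ - fderiv ℝ F ζ h‖ ≤ K * (M * M) * ‖w‖ ^ 2 := by
      have hseg : segment ℝ ζ (ζ + h) ⊆ closedBall (p, q) (2 * r) :=
        (convex_closedBall _ _).segment_subset hB hB'
      have h1 := (convex_segment ζ (ζ + h)).norm_image_sub_le_of_norm_fderiv_le'
        (f := F) (φ := fderiv ℝ F ζ) (C := K * ‖h‖) (fun x hx ↦ hF x (hseg hx))
        (fun x hx ↦ by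
          refine (hK'.norm_sub_le (hseg hx) hB).trans ?_
          gcongr
          simpa using norm_sub_le_of_mem_segment hx)
        (left_mem_segment ..) (right_mem_segment ..)
      rw [add_sub_cancel_left] at h1
      refine h1.trans ?_
      calc K * ‖h‖ * ‖h‖ ≤ K * (M * ‖w‖) * (M * ‖w‖) := by gcongr
        _ = _ := by ring
    have hlin : t • fderiv ℝ F ζ (w, F ζ w) v = fderiv ℝ F ζ h v := by
      rw [hh, ← Prod.smul_mk, map_smul, smul_apply]
    have heq : F ζ (v + w) + t • fderiv ℝ F ζ (w, F ζ w) v - F (ζ + h) (v + w) =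
        -(fderiv ℝ F ζ h w) - (F (ζ + h) - F ζ - fderiv ℝ F ζ h) (v + w) := by
      rw [hlin]
      simp only [sub_apply, map_add]
      abel
    rw [hζh, dist_eq_norm, heq]
    have h1 : ‖fderiv ℝ F ζ h w‖ ≤ M * M * ‖w‖ ^ 2 := by
      refine (ContinuousLinearMap.le_opNorm₂ _ _ _).trans ?_
      calc _ ≤ (M : ℝ) * (M * ‖w‖) * ‖w‖ := by gcongr; exact hM' _ hB
        _ = _ := by ring
    have h2 : ‖(F (ζ + h) - F ζ - fderiv ℝ F ζ h) (v + w)‖ ≤ K * (M * M) * ‖w‖ ^ 2 :=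
      ((ContinuousLinearMap.le_opNorm _ _).trans
        (mul_le_of_le_one_right (norm_nonneg _) hvw1)).trans hrem
    refine (norm_sub_le _ _).trans ?_
    rw [norm_neg]
    linarith

/-- **Frobenius theorem** for total differential equations `df = F (x, f)`. -/
theorem exists_hasFDerivAt_of_integrable [CompleteSpace G] (hF : ContDiffAt ℝ 2 F (p, q))
    (hint : ∀ᶠ z in 𝓝 (p, q), ∀ v w : E,
      fderiv ℝ F z (v, F z v) w = fderiv ℝ F z (w, F z w) v) :
    ∃ f : E → G, f p = q ∧ ∀ᶠ x in 𝓝 p, HasFDerivAt f (F (x, f x)) x := by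
  have hF1 : ContDiffAt ℝ 1 F (p, q) := hF.of_le (by norm_num)
  have hF' : ContDiffAt ℝ 1 (fderiv ℝ F) (p, q) := hF.fderiv_right (by norm_num)
  obtain ⟨K₁, s₁, hs₁, hK₁⟩ := hF1.exists_lipschitzOnWith
  obtain ⟨K₂, s₂, hs₂, hK₂⟩ := hF'.exists_lipschitzOnWith
  obtain ⟨M₁, hM₁⟩ : ∃ M : ℝ≥0, ‖F (p, q)‖ < M := ⟨‖F (p, q)‖₊ + 1, by simp⟩
  obtain ⟨M₂, hM₂⟩ : ∃ M : ℝ≥0, ‖fderiv ℝ F (p, q)‖ < M := ⟨‖fderiv ℝ F (p, q)‖₊ + 1, by simp⟩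
  have hc' : ContinuousAt (fun z ↦ ‖fderiv ℝ F z‖) (p, q) :=
    (continuous_norm (E := E × G →L[ℝ] E →L[ℝ] G)).continuousAt.comp
      hF'.continuousAt
  have hev : ∀ᶠ z in 𝓝 (p, q), z ∈ s₁ ∧ z ∈ s₂ ∧ ‖F z‖ < M₁ ∧ ‖fderiv ℝ F z‖ < M₂ ∧
      DifferentiableAt ℝ F z ∧ ∀ v w : E, fderiv ℝ F z (v, F z v) w = fderiv ℝ F z (w, F z w) v := by
    filter_upwards [hs₁, hs₂, hF1.continuousAt.norm.eventually_lt_const hM₁,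
      hc'.eventually_lt_const hM₂,
      (hF1.eventually (by simp)).mono (fun z hz ↦ hz.differentiableAt one_ne_zero), hint]
      with z h1 h2 h3 h4 h5 h6 using ⟨h1, h2, h3, h4, h5, h6⟩
  obtain ⟨R, hR, hball⟩ := Metric.nhds_basis_closedBall.eventually_iff.1 hev
  obtain ⟨r, rfl⟩ : ∃ r, R = 2 * r := ⟨R / 2, by ring⟩
  have hr : 0 < r := by linarith
  set K : ℝ≥0 := max (max K₁ K₂) 1
  set M : ℝ≥0 := max (max M₁ M₂) 1
  have hK0 : 0 < K := lt_of_lt_of_le one_pos (le_max_right _ _)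
  have hM1 : 1 ≤ M := le_max_right _ _
  have hKF : LipschitzOnWith K F (closedBall (p, q) (2 * r)) :=
    (hK₁.mono fun z hz ↦ (hball hz).1).weaken ((le_max_left _ _).trans (le_max_left _ _))
  have hKF' : LipschitzOnWith K (fderiv ℝ F) (closedBall (p, q) (2 * r)) :=
    (hK₂.mono fun z hz ↦ (hball hz).2.1).weaken ((le_max_right _ _).trans (le_max_left _ _))
  have hMF : ∀ z ∈ closedBall (p, q) (2 * r), ‖F z‖ ≤ M := fun z hz ↦
    (hball hz).2.2.1.le.trans (by exact_mod_cast (le_max_left _ _).trans (le_max_left _ _))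
  have hMF' : ∀ z ∈ closedBall (p, q) (2 * r), ‖fderiv ℝ F z‖ ≤ M := fun z hz ↦
    (hball hz).2.2.2.1.le.trans (by exact_mod_cast (le_max_right _ _).trans (le_max_left _ _))
  have hsub : closedBall (p, q) r ⊆ closedBall (p, q) (2 * r) :=
    closedBall_subset_closedBall (by linarith)
  have hsol : ∀ v : E, ∃ y : ℝ → G, ‖v‖ ≤ r → M * ‖v‖ ≤ r →
      y 0 = q ∧ ∀ t ∈ Icc (0 : ℝ) 1, y t ∈ closedBall q r ∧
        HasDerivWithinAt y (F (p + t • v, y t) v) (Icc 0 1) t := by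
    intro v
    by_cases h : ‖v‖ ≤ r ∧ M * ‖v‖ ≤ r
    · obtain ⟨y, hy⟩ := exists_segment_solution hr.le (hKF.mono hsub)
        (fun z hz ↦ hMF z (hsub hz)) h.1 h.2
      exact ⟨y, fun _ _ ↦ hy⟩
    · exact ⟨0, fun h1 h2 ↦ absurd ⟨h1, h2⟩ h⟩
  choose y hy using hsol
  have hsmall : ∀ v₀ : E, ‖v₀‖ < r → ‖v₀‖ < 1 → M * ‖v₀‖ < r →
      ∀ᶠ v in 𝓝 v₀, ‖v‖ < r ∧ ‖v‖ < 1 ∧ M * ‖v‖ < r := fun v₀ h1 h2 h3 ↦ by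
    refine ((continuous_norm.tendsto v₀).eventually_lt_const h1).and
      (((continuous_norm.tendsto v₀).eventually_lt_const h2).and
        (Tendsto.eventually_lt_const h3 ?_))
    exact (continuous_const.mul continuous_norm).tendsto v₀
  refine ⟨fun x ↦ y (x - p) 1, ?_, ?_⟩
  · have h0 := hy 0 (by simpa using hr.le) (by simpa using hr.le)
    have hconst := constant_of_derivWithin_zero (f := y 0) (a := 0) (b := 1)
      (fun t ht ↦ (h0.2 t ht).2.differentiableWithinAt)
      (fun t ht ↦ by
        have ht' := Ico_subset_Icc_self ht
        simpa using (h0.2 t ht').2.derivWithin (uniqueDiffOn_Icc one_pos t ht')) 1 (by simp)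
    simpa [h0.1] using hconst
  · have hp : ∀ᶠ x in 𝓝 p, ‖x - p‖ < r ∧ ‖x - p‖ < 1 ∧ M * ‖x - p‖ < r := by
      have hc : Tendsto (fun x ↦ x - p) (𝓝 p) (𝓝 0) := by
        simpa using (continuous_sub_right p).tendsto p
      exact hc.eventually (hsmall 0 (by simpa using hr) (by simp) (by simpa using hr))
    filter_upwards [hp] with x hx
    rw [hasFDerivAt_iff_isLittleO_nhds_zero]
    refine Asymptotics.IsBigO.trans_isLittleO (g := fun w : E ↦ ‖w‖ ^ 2) ?_
      (Asymptotics.isLittleO_norm_pow_id one_lt_two)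
    have hc : Tendsto (fun w ↦ x - p + w) (𝓝 0) (𝓝 (x - p)) := by
      simpa using (continuous_const_add (x - p)).tendsto 0
    refine Asymptotics.IsBigO.of_bound ((M * M + K * (M * M)) / K * (Real.exp K - 1)) ?_
    filter_upwards [hc.eventually (hsmall (x - p) hx.1 hx.2.1 hx.2.2),
      hsmall 0 (by simpa using hr) (by simp) (by simpa using hr)] with w hw hw0
    obtain ⟨hy1, hy2⟩ := hy (x - p) hx.1.le hx.2.2.le
    obtain ⟨hy1', hy2'⟩ := hy (x - p + w) hw.1.le hw.2.2.le
    have := norm_segment_solution_sub_le (fun z hz ↦ (hball hz).2.2.2.2.1) hKF hKF' hMF hMF'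
      (fun z hz ↦ (hball hz).2.2.2.2.2) hM1 hK0 hx.1.le hw.1.le hw.2.1.le hw0.2.2.le
      hy1 hy1' hy2 hy2'
    rw [add_sub_cancel] at this
    rw [Real.norm_of_nonneg (sq_nonneg _), add_sub_right_comm]
    exact this

/-- Solutions of `df = F (x, f)` are as smooth as `F`. -/
theorem contDiffOn_infty_of_hasFDerivAt {f : E → G} {W : Set E} {S : Set (E × G)} (hW : IsOpen W)
    (hF : ContDiffOn ℝ (⊤ : ℕ∞) F S) (hS : ∀ x ∈ W, (x, f x) ∈ S)
    (hf : ∀ x ∈ W, HasFDerivAt f (F (x, f x)) x) : ContDiffOn ℝ (⊤ : ℕ∞) f W := by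
  have hd : DifferentiableOn ℝ f W := fun x hx ↦ (hf x hx).differentiableAt.differentiableWithinAt
  rw [contDiffOn_infty]
  intro n
  induction n with
  | zero => exact contDiffOn_zero.2 hd.continuousOn
  | succ n ih =>
    push_cast
    rw [contDiffOn_succ_iff_fderiv_of_isOpen hW]
    refine ⟨hd, by simp, ?_⟩
    refine ContDiffOn.congr (f := fun x ↦ F (x, f x)) ?_ fun x hx ↦ (hf x hx).fderiv
    exact (hF.of_le (by exact_mod_cast le_top)).comp (contDiffOn_id.prodMk ih) hS

/-- The integrability condition satisfied by a total differential equation `df = F (x, f)`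
along each of its solutions. -/
theorem fderiv_apply_comm_of_hasFDerivAt {f : E → G} {x : E}
    (hF : DifferentiableAt ℝ F (x, f x)) (hf : ∀ᶠ x' in 𝓝 x, HasFDerivAt f (F (x', f x')) x')
    (v w : E) :
    fderiv ℝ F (x, f x) (v, F (x, f x) v) w = fderiv ℝ F (x, f x) (w, F (x, f x) w) v := by
  have h1 : HasFDerivAt (fun x' ↦ (x', f x')) ((ContinuousLinearMap.id ℝ E).prod (F (x, f x))) x :=
    (hasFDerivAt_id x).prodMk hf.self_of_nhds
  have h2 := hF.hasFDerivAt.comp x h1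
  simpa using second_derivative_symmetric_of_eventually_of_real hf h2 v w

end Frobenius

section Splitting

variable {n : ℕ} {U : Set (Fin n → ℝ)} {eps : (Fin n → ℝ) → (Fin n → ℝ) → Fin n → Fin n → ℝ}

/-- The matrix `eps x y` as a continuous linear map, depending on the pair `(x, y)`. -/
def epsCLM (eps : (Fin n → ℝ) → (Fin n → ℝ) → Fin n → Fin n → ℝ)
    (z : (Fin n → ℝ) × (Fin n → ℝ)) : (Fin n → ℝ) →L[ℝ] (Fin n → ℝ) :=
  ContinuousLinearMap.pi fun i ↦ ∑ k, eps z.1 z.2 i k • ContinuousLinearMap.proj k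

lemma epsCLM_apply (z : (Fin n → ℝ) × (Fin n → ℝ)) (v : Fin n → ℝ) (i : Fin n) :
    epsCLM eps z v i = ∑ k, eps z.1 z.2 i k * v k := by
  simp [epsCLM]

lemma epsCLM_single (z : (Fin n → ℝ) × (Fin n → ℝ)) (i k : Fin n) :
    epsCLM eps z (Pi.single k 1) i = eps z.1 z.2 i k := by
  simp [epsCLM_apply, Pi.single_apply]

lemma IsSplitting.contDiffOn_epsCLM (heps : IsSplitting U eps) :
    ContDiffOn ℝ (⊤ : ℕ∞) (epsCLM eps) (U ×ˢ U) := by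
  rw [contDiffOn_clm_apply]
  intro v
  rw [contDiffOn_pi]
  intro i
  simp only [epsCLM_apply]
  exact ContDiffOn.sum fun k _ ↦ (heps.smooth i k).mul contDiffOn_const

lemma hasFDerivAt_eps_and_fderiv_apply {z : (Fin n → ℝ) × (Fin n → ℝ)}
    (hz : DifferentiableAt ℝ (epsCLM eps) z) (u : (Fin n → ℝ) × (Fin n → ℝ)) (i k : Fin n) :
    HasFDerivAt (fun z' : (Fin n → ℝ) × (Fin n → ℝ) ↦ eps z'.1 z'.2 i k)
      (fderiv ℝ (fun z' : (Fin n → ℝ) × (Fin n → ℝ) ↦ eps z'.1 z'.2 i k) z) z ∧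
    fderiv ℝ (fun z' : (Fin n → ℝ) × (Fin n → ℝ) ↦ eps z'.1 z'.2 i k) z u =
      fderiv ℝ (epsCLM eps) z u (Pi.single k 1) i := by
  have h1 := hasFDerivAt_pi'.1
    (hz.hasFDerivAt.clm_apply (hasFDerivAt_const (Pi.single k (1 : ℝ) : Fin n → ℝ) z)) i
  simp only [epsCLM_single] at h1
  refine ⟨h1.differentiableAt.hasFDerivAt, ?_⟩
  rw [h1.fderiv]
  simp

lemma Rg_eq {x y : Fin n → ℝ} (hz : DifferentiableAt ℝ (epsCLM eps) (x, y)) (i j k : Fin n) :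
    Rg eps i j k x y =
      fderiv ℝ (epsCLM eps) (x, y) (Pi.single j 1, epsCLM eps (x, y) (Pi.single j 1))
        (Pi.single k 1) i -
      fderiv ℝ (epsCLM eps) (x, y) (Pi.single k 1, epsCLM eps (x, y) (Pi.single k 1))
        (Pi.single j 1) i := by
  have key : ∀ j k : Fin n, pd j (fun x' ↦ eps x' y i k) x +
      ∑ a, pd a (fun y' ↦ eps x y' i k) y * eps x y a j =
      fderiv ℝ (epsCLM eps) (x, y) (Pi.single j 1, epsCLM eps (x, y) (Pi.single j 1))
        (Pi.single k 1) i := by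
    intro j k
    rw [← (hasFDerivAt_eps_and_fderiv_apply hz _ i k).2]
    have hg := (hasFDerivAt_eps_and_fderiv_apply hz 0 i k).1
    set L := fderiv ℝ (fun z' : (Fin n → ℝ) × (Fin n → ℝ) ↦ eps z'.1 z'.2 i k) (x, y)
    have hx : pd j (fun x' ↦ eps x' y i k) x = L (Pi.single j 1, 0) := by
      have h : HasFDerivAt (fun x' ↦ eps x' y i k) (L.comp (ContinuousLinearMap.inl ℝ _ _)) x :=
        hg.comp x (f := fun x' ↦ (x', y)) (hasFDerivAt_prodMk_left x y)
      rw [pd, h.fderiv]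
      simp
    have hy : ∀ a, pd a (fun y' ↦ eps x y' i k) y = L (0, Pi.single a 1) := by
      intro a
      have h : HasFDerivAt (fun y' ↦ eps x y' i k) (L.comp (ContinuousLinearMap.inr ℝ _ _)) y :=
        hg.comp y (f := fun y' ↦ (x, y')) (hasFDerivAt_prodMk_right x y)
      rw [pd, h.fderiv]
      simp
    have hsum : L (0, epsCLM eps (x, y) (Pi.single j 1)) =
        ∑ a, L (0, Pi.single a 1) * eps x y a j := by
      have h := congrArg (L.comp (ContinuousLinearMap.inr ℝ _ _))
        (pi_eq_sum_univ' (epsCLM eps (x, y) (Pi.single j 1)))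
      simp only [map_sum, map_smul, epsCLM_single] at h
      simpa [mul_comm, Pi.single_apply] using h
    simp only [hx, hy]
    rw [← hsum, ← map_add]
    simp
  rw [← key j k, ← key k j, Rg]
  ring

lemma forall_Rg_eq_zero_iff {x y : Fin n → ℝ} (hz : DifferentiableAt ℝ (epsCLM eps) (x, y)) :
    (∀ i j k : Fin n, Rg eps i j k x y = 0) ↔ ∀ v w : Fin n → ℝ,
      fderiv ℝ (epsCLM eps) (x, y) (v, epsCLM eps (x, y) v) w =
        fderiv ℝ (epsCLM eps) (x, y) (w, epsCLM eps (x, y) w) v := by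
  simp only [Rg_eq hz, sub_eq_zero]
  refine ⟨fun h ↦ ?_, fun h i j k ↦ by rw [h]⟩
  set B := (fderiv ℝ (epsCLM eps) (x, y)).comp
    ((ContinuousLinearMap.id ℝ (Fin n → ℝ)).prod (epsCLM eps (x, y))) with hB
  have hBs : B.toLinearMap₁₂ = B.flip.toLinearMap₁₂ := by
    refine LinearMap.ext_basis (Pi.basisFun ℝ (Fin n)) (Pi.basisFun ℝ (Fin n)) fun j k ↦ ?_
    ext i
    simpa [hB] using h i j k
  intro v w
  exact congrArg (fun b ↦ b v w) hBs

end Splitting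

/-- The groupoid curvature `R` vanishes identically on `U × U` iff for every
pair `(p,q) ∈ U × U` there is an open neighborhood `W ⊆ U` of `p` and a smooth
`f : W → U` with `f p = q` solving `∂f^i/∂x^j = ε^i_j(x, f(x))` on `W`. -/
theorem stmt_0 {n : ℕ} (hn : 2 ≤ n) (U : Set (Fin n → ℝ)) (hU : IsOpen U)
    (eps : (Fin n → ℝ) → (Fin n → ℝ) → Fin n → Fin n → ℝ) (heps : IsSplitting U eps) :
    (∀ x ∈ U, ∀ y ∈ U, ∀ i j k : Fin n, Rg eps i j k x y = 0) ↔
      (∀ p ∈ U, ∀ q ∈ U, ∃ (W : Set (Fin n → ℝ)) (f : (Fin n → ℝ) → (Fin n → ℝ)),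
        IsOpen W ∧ W ⊆ U ∧ p ∈ W ∧ Set.MapsTo f W U ∧ ContDiffOn ℝ (⊤ : ℕ∞) f W ∧
        f p = q ∧ ∀ x ∈ W, ∀ i j : Fin n, pd j (fun x' => f x' i) x = eps x (f x) i j) := by
  have hUU : IsOpen (U ×ˢ U) := hU.prod hU
  have hsm : ∀ x ∈ U, ∀ y ∈ U, ContDiffAt ℝ (⊤ : ℕ∞) (epsCLM eps) (x, y) := fun x hx y hy ↦
    heps.contDiffOn_epsCLM.contDiffAt (hUU.mem_nhds ⟨hx, hy⟩)
  have hdiff : ∀ x ∈ U, ∀ y ∈ U, DifferentiableAt ℝ (epsCLM eps) (x, y) := fun x hx y hy ↦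
    (hsm x hx y hy).differentiableAt (by simp)
  constructor
  · intro hR p hp q hq
    have hint : ∀ᶠ z in 𝓝 (p, q), ∀ v w, fderiv ℝ (epsCLM eps) z (v, epsCLM eps z v) w =
        fderiv ℝ (epsCLM eps) z (w, epsCLM eps z w) v := by
      filter_upwards [hUU.mem_nhds ⟨hp, hq⟩] with z hz
      exact (forall_Rg_eq_zero_iff (hdiff _ hz.1 _ hz.2)).1 (hR _ hz.1 _ hz.2)
    obtain ⟨f, hfp, hf⟩ := exists_hasFDerivAt_of_integrable
      ((hsm p hp q hq).of_le (WithTop.coe_le_coe.2 le_top)) hint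
    have hfU : ∀ᶠ x in 𝓝 p, f x ∈ U :=
      hf.self_of_nhds.continuousAt.eventually (hU.mem_nhds (hfp ▸ hq))
    obtain ⟨W, hW, hWo, hpW⟩ := _root_.eventually_nhds_iff.1 (hf.and (hfU.and (hU.mem_nhds hp)))
    refine ⟨W, f, hWo, fun x hx ↦ (hW x hx).2.2, hpW, fun x hx ↦ (hW x hx).2.1, ?_, hfp, ?_⟩
    · exact contDiffOn_infty_of_hasFDerivAt hWo heps.contDiffOn_epsCLM
        (fun x hx ↦ ⟨(hW x hx).2.2, (hW x hx).2.1⟩) fun x hx ↦ (hW x hx).1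
    · intro x hx i j
      rw [pd, (hasFDerivAt_pi'.1 (hW x hx).1 i).fderiv]
      exact epsCLM_single (x, f x) i j
  · intro h p hp q hq
    obtain ⟨W, f, hWo, hWU, hpW, hmaps, hfs, rfl, hpd⟩ := h p hp q hq
    rw [forall_Rg_eq_zero_iff (hdiff p hp _ hq)]
    refine fderiv_apply_comm_of_hasFDerivAt (hdiff p hp _ hq) ?_
    filter_upwards [hWo.mem_nhds hpW] with x hx
    have hd := ((hfs.contDiffAt (hWo.mem_nhds hx)).differentiableAt (by simp)).hasFDerivAt
    refine hd.congr_fderiv (ContinuousLinearMap.coe_injective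
      ((Pi.basisFun ℝ (Fin n)).ext fun j ↦ ?_))
    ext i
    have hij := hpd x hx i j
    rw [pd, (hasFDerivAt_pi'.1 hd i).fderiv] at hij
    simpa [epsCLM_single] using hij
end
end

section
/- Let ε be a splitting on an open set U ⊆ ℝⁿ and let W₁, W₂ ⊆ U be open. Suppose f : W₁ → U is smooth with f(W₁) ⊆ W₂ and g : W₂ → U is smooth, and both solve the system: ∂f^i(x)/∂x^j = ε^i_j(x, f(x)) on W₁ and ∂g^i(y)/∂y^j = ε^i_j(y, g(y)) on W₂. Then the composition g∘f solves the same system on W₁, i.e. ∂(g∘f)^i(x)/∂x^j = ε^i_j(x, g(f(x))). Moreover, if f is a diffeomorphism from W₁ onto an open set W ⊆ U, then its inverse solves the system on W: ∂(f^{-1})^i(y)/∂y^j = ε^i_j(y, f^{-1}(y)). (Thus the local solutions of the system form a pseudogroup.) -/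
noncomputable section

open Set

theorem fderiv_apply_eq_sum_pd {n : ℕ} (h : (Fin n → ℝ) → ℝ) (y v : Fin n → ℝ) :
    fderiv ℝ h y v = ∑ a, pd a h y * v a := by
  conv_lhs => rw [pi_eq_sum_univ' v]
  rw [map_sum]
  refine Finset.sum_congr rfl fun a _ => ?_
  rw [map_smul, smul_eq_mul, mul_comm, pd]

theorem pd_comp {n : ℕ} {f : (Fin n → ℝ) → (Fin n → ℝ)} {h : (Fin n → ℝ) → ℝ}
    {x : Fin n → ℝ} (hh : DifferentiableAt ℝ h (f x)) (hf : DifferentiableAt ℝ f x)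
    (j : Fin n) :
    pd j (fun x' => h (f x')) x = ∑ a, pd a h (f x) * pd j (fun x' => f x' a) x := by
  have hc : fderiv ℝ (fun x' => h (f x')) x = (fderiv ℝ h (f x)).comp (fderiv ℝ f x) :=
    fderiv_comp x hh hf
  rw [pd, hc, ContinuousLinearMap.comp_apply, fderiv_apply_eq_sum_pd]
  refine Finset.sum_congr rfl fun a _ => ?_
  have ha : HasFDerivAt (fun x' => f x' a)
      ((ContinuousLinearMap.proj (R := ℝ) (φ := fun _ : Fin n => ℝ) a).comp (fderiv ℝ f x)) x :=
    hasFDerivAt_pi'.1 hf.hasFDerivAt a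
  rw [pd.eq_def j, ha.fderiv]
  rfl

theorem pd_coord {n : ℕ} (i j : Fin n) (y : Fin n → ℝ) :
    pd j (fun y' => y' i) y = if i = j then (1 : ℝ) else 0 := by
  have h : HasFDerivAt (fun y' : Fin n → ℝ => y' i)
      (ContinuousLinearMap.proj (R := ℝ) (φ := fun _ : Fin n => ℝ) i) y := hasFDerivAt_apply i y
  rw [pd, h.fderiv]
  simp [Pi.single_apply]

theorem differentiableAt_of_smoothOn {n : ℕ} {f : (Fin n → ℝ) → (Fin n → ℝ)}
    {W : Set (Fin n → ℝ)} (hW : IsOpen W) (hf : ContDiffOn ℝ (⊤ : ℕ∞) f W)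
    {x : Fin n → ℝ} (hx : x ∈ W) : DifferentiableAt ℝ f x :=
  (hf.contDiffAt (hW.mem_nhds hx)).differentiableAt (by simp)

/-- The local solutions of `∂f^i/∂x^j = ε^i_j(x, f(x))` are closed under
composition and inversion (they form a pseudogroup). -/
theorem stmt_2 {n : ℕ} (hn : 2 ≤ n) (U W₁ W₂ : Set (Fin n → ℝ)) (hU : IsOpen U)
    (hW₁ : IsOpen W₁) (hW₂ : IsOpen W₂) (hW₁U : W₁ ⊆ U) (hW₂U : W₂ ⊆ U)
    (eps : (Fin n → ℝ) → (Fin n → ℝ) → Fin n → Fin n → ℝ) (heps : IsSplitting U eps)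
    (f g : (Fin n → ℝ) → (Fin n → ℝ))
    (hf : ContDiffOn ℝ (⊤ : ℕ∞) f W₁) (hfW : Set.MapsTo f W₁ W₂)
    (hg : ContDiffOn ℝ (⊤ : ℕ∞) g W₂) (hgU : Set.MapsTo g W₂ U)
    (hfE : ∀ x ∈ W₁, ∀ i j : Fin n, pd j (fun x' => f x' i) x = eps x (f x) i j)
    (hgE : ∀ y ∈ W₂, ∀ i j : Fin n, pd j (fun y' => g y' i) y = eps y (g y) i j) :
    (∀ x ∈ W₁, ∀ i j : Fin n, pd j (fun x' => g (f x') i) x = eps x (g (f x)) i j) ∧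
    (∀ (W : Set (Fin n → ℝ)) (f' : (Fin n → ℝ) → (Fin n → ℝ)),
      IsOpen W → W ⊆ U → f '' W₁ = W → ContDiffOn ℝ (⊤ : ℕ∞) f' W → Set.MapsTo f' W W₁ →
      (∀ x ∈ W₁, f' (f x) = x) → (∀ y ∈ W, f (f' y) = y) →
      ∀ y ∈ W, ∀ i j : Fin n, pd j (fun y' => f' y' i) y = eps y (f' y) i j) := by
  refine ⟨fun x hx i j => ?_, fun W f' hW hWU _ hf' hf'W _ hff' y hy i j => ?_⟩
  · have hgx := differentiableAt_of_smoothOn hW₂ hg (hfW hx)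
    rw [pd_comp (h := fun y => g y i) (differentiableAt_pi.1 hgx i)
      (differentiableAt_of_smoothOn hW₁ hf hx)]
    simp only [hgE _ (hfW hx), hfE _ hx]
    exact heps.comp _ (hW₁U hx) _ (hgU (hfW hx)) _ (hW₂U (hfW hx)) i j
  · have hx := hf'W hy
    have hyU := hWU hy
    have hxU := hW₁U hx
    have hleft : ∀ a, ∑ k, eps (f' y) y a k * pd j (fun y' => f' y' k) y =
        if a = j then (1 : ℝ) else 0 := by
      intro a
      have hfx := differentiableAt_of_smoothOn hW₁ hf hx
      have hc := pd_comp (h := fun x => f x a) (differentiableAt_pi.1 hfx a)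
        (differentiableAt_of_smoothOn hW hf' hy) j
      simp only [hfE _ hx, hff' y hy] at hc
      rw [← hc, ← pd_coord a j y, pd, pd]
      congr 1
      apply Filter.EventuallyEq.fderiv_eq
      filter_upwards [hW.mem_nhds hy] with z hz
      rw [hff' z hz]
    calc pd j (fun y' => f' y' i) y
        = ∑ k, eps (f' y) (f' y) i k * pd j (fun y' => f' y' k) y := by
          simp [heps.refl _ hxU]
      _ = ∑ k, (∑ a, eps y (f' y) i a * eps (f' y) y a k) * pd j (fun y' => f' y' k) y := by
          simp only [heps.comp _ hxU _ hxU _ hyU]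
      _ = ∑ a, eps y (f' y) i a * ∑ k, eps (f' y) y a k * pd j (fun y' => f' y' k) y := by
          simp only [Finset.sum_mul, Finset.mul_sum, mul_assoc]
          exact Finset.sum_comm
      _ = eps y (f' y) i j := by
          simp [hleft]
end
end

section
/- For every splitting ε on an open set U ⊆ ℝⁿ, the identity ∂Γ^i_{jk}(x)/∂x^r + Γ^a_{rk}(x)Γ^i_{ja}(x) − ∂Γ^i_{rk}(x)/∂x^j − Γ^a_{jk}(x)Γ^i_{ra}(x) = 0 holds for all x ∈ U and all indices i,j,k,r. (That is, the integrability conditions of the linear system ∂ξ^i/∂x^r = Γ^i_{ra}ξ^a are identically satisfied on a parallelizable manifold: the curvature 𝔯̃ always vanishes.) -/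
noncomputable section

open Set

theorem pd_congr_of_eventuallyEq {n : ℕ} {f g : (Fin n → ℝ) → ℝ} {x : Fin n → ℝ}
    (h : f =ᶠ[nhds x] g) (j : Fin n) : pd j f x = pd j g x := by
  rw [pd, pd, h.fderiv_eq]

theorem pd_sum_mul {n : ℕ} {f g : Fin n → (Fin n → ℝ) → ℝ} {x : Fin n → ℝ}
    (hf : ∀ a, DifferentiableAt ℝ (f a) x) (hg : ∀ a, DifferentiableAt ℝ (g a) x) (j : Fin n) :
    pd j (fun y => ∑ a, f a y * g a y) x
      = ∑ a, (f a x * pd j (g a) x + g a x * pd j (f a) x) := by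
  have h : HasFDerivAt (fun y => ∑ a, f a y * g a y)
      (∑ a, (f a x • fderiv ℝ (g a) x + g a x • fderiv ℝ (f a) x)) x :=
    HasFDerivAt.fun_sum fun a _ => (hf a).hasFDerivAt.mul (hg a).hasFDerivAt
  simp [pd, h.fderiv]

theorem differentiableAt_pd {n : ℕ} {f : (Fin n → ℝ) → ℝ} {x : Fin n → ℝ}
    (hf : ContDiffAt ℝ 2 f x) (j : Fin n) : DifferentiableAt ℝ (pd j f) x :=
  ((hf.fderiv_right (m := 1) (by norm_num)).differentiableAt (by norm_num)).clm_apply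
    (differentiableAt_const _)

theorem pd_pd_comm {n : ℕ} {f : (Fin n → ℝ) → ℝ} {x : Fin n → ℝ}
    (hf : ContDiffAt ℝ 2 f x) (j k : Fin n) : pd j (pd k f) x = pd k (pd j f) x := by
  have hd : DifferentiableAt ℝ (fderiv ℝ f) x :=
    (hf.fderiv_right (m := 1) (by norm_num)).differentiableAt (by norm_num)
  have key (a b : Fin n) :
      pd a (pd b f) x = fderiv ℝ (fderiv ℝ f) x (Pi.single a 1) (Pi.single b 1) := by
    change fderiv ℝ (fun y => fderiv ℝ f y (Pi.single b 1)) x (Pi.single a 1) = _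
    rw [fderiv_clm_apply hd (differentiableAt_const _)]
    simp
  rw [key, key]
  exact hf.isSymmSndFDerivAt (by simp) _ _

namespace IsSplitting

variable {n : ℕ} {U : Set (Fin n → ℝ)} {eps : (Fin n → ℝ) → (Fin n → ℝ) → Fin n → Fin n → ℝ}

theorem contDiffAt (heps : IsSplitting U eps) (hU : IsOpen U) {x y : Fin n → ℝ}
    (hx : x ∈ U) (hy : y ∈ U) (i j : Fin n) :
    ContDiffAt ℝ 2 (fun p : (Fin n → ℝ) × (Fin n → ℝ) => eps p.1 p.2 i j) (x, y) :=
  ((heps.smooth i j).contDiffAt ((hU.prod hU).mem_nhds ⟨hx, hy⟩)).of_le 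
    (WithTop.coe_le_coe.2 (le_top : (2 : ℕ∞) ≤ ⊤))

theorem contDiffAt_left (heps : IsSplitting U eps) (hU : IsOpen U) {x y : Fin n → ℝ}
    (hx : x ∈ U) (hy : y ∈ U) (i j : Fin n) : ContDiffAt ℝ 2 (fun z => eps z y i j) x :=
  (heps.contDiffAt hU hx hy i j).comp x (contDiffAt_id.prodMk contDiffAt_const)

theorem contDiffAt_right (heps : IsSplitting U eps) (hU : IsOpen U) {x y : Fin n → ℝ}
    (hx : x ∈ U) (hy : y ∈ U) (i j : Fin n) : ContDiffAt ℝ 2 (fun z => eps x z i j) y :=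
  (heps.contDiffAt hU hx hy i j).comp y (contDiffAt_const.prodMk contDiffAt_id)

/-- Composing at the base point `z`, `∂_j ε^i_k(x,y) = ∂_j ε^i_a(z,y) ε^a_k(x,z)`. -/
theorem pd_eps (heps : IsSplitting U eps) (hU : IsOpen U) {x y z : Fin n → ℝ}
    (hx : x ∈ U) (hy : y ∈ U) (hz : z ∈ U) (i j k : Fin n) :
    pd j (fun w => eps x w i k) y = ∑ a, pd j (fun w => eps z w i a) y * eps x z a k := by
  have h : (fun w => eps x w i k) =ᶠ[nhds y] fun w => ∑ a, eps z w i a * eps x z a k := by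
    filter_upwards [hU.mem_nhds hy] with w hw
    exact (heps.comp x hx w hw z hz i k).symm
  rw [pd_congr_of_eventuallyEq h, pd_sum_mul
    (fun a => (heps.contDiffAt_right hU hz hy i a).differentiableAt (by norm_num))
    (fun a => differentiableAt_const _)]
  simp [pd, mul_comm]

theorem differentiableAt_Gam (heps : IsSplitting U eps) (hU : IsOpen U) {x : Fin n → ℝ}
    (hx : x ∈ U) (i j k : Fin n) : DifferentiableAt ℝ (Gam eps i j k) x := by
  have h : Gam eps i j k =ᶠ[nhds x]
      fun y => ∑ a, pd j (fun w => eps x w i a) y * eps y x a k := by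
    filter_upwards [hU.mem_nhds hx] with y hy
    exact heps.pd_eps hU hy hy hx i j k
  refine DifferentiableAt.congr_of_eventuallyEq ?_ h
  exact DifferentiableAt.fun_sum fun a _ =>
    (differentiableAt_pd (heps.contDiffAt_right hU hx hx i a) j).mul
      ((heps.contDiffAt_left hU hx hx a k).differentiableAt (by norm_num))

/-- The second derivatives of `ε(x,·)` on the diagonal, in terms of `Γ`. -/
theorem pd_pd_eps (heps : IsSplitting U eps) (hU : IsOpen U) {x : Fin n → ℝ}
    (hx : x ∈ U) (i j k r : Fin n) :
    pd r (pd j (fun y => eps x y i k)) x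
      = pd r (Gam eps i j k) x + ∑ a, Gam eps a r k x * Gam eps i j a x := by
  have h : pd j (fun y => eps x y i k) =ᶠ[nhds x]
      fun y => ∑ a, Gam eps i j a y * eps x y a k := by
    filter_upwards [hU.mem_nhds hx] with y hy
    exact heps.pd_eps hU hx hy hy i j k
  rw [pd_congr_of_eventuallyEq h, pd_sum_mul
    (fun a => heps.differentiableAt_Gam hU hx i j a)
    (fun a => (heps.contDiffAt_right hU hx hx a k).differentiableAt (by norm_num)),
    Finset.sum_add_distrib, add_comm]
  congr 1
  · simp [heps.refl x hx]
  · exact Finset.sum_congr rfl fun a _ => mul_comm _ _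

end IsSplitting

/-- The curvature `𝔯̃` always vanishes on a parallelizable manifold:
`∂Γ^i_{jk}/∂x^r + Γ^a_{rk}Γ^i_{ja} − ∂Γ^i_{rk}/∂x^j − Γ^a_{jk}Γ^i_{ra} = 0`. -/
theorem stmt_3 {n : ℕ} (hn : 2 ≤ n) (U : Set (Fin n → ℝ)) (hU : IsOpen U)
    (eps : (Fin n → ℝ) → (Fin n → ℝ) → Fin n → Fin n → ℝ) (heps : IsSplitting U eps) :
    ∀ x ∈ U, ∀ i j k r : Fin n,
      pd r (Gam eps i j k) x + ∑ a, Gam eps a r k x * Gam eps i j a x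
        - pd j (Gam eps i r k) x - ∑ a, Gam eps a j k x * Gam eps i r a x = 0 := by
  intro x hx i j k r
  have h := pd_pd_comm (heps.contDiffAt_right hU hx hx i k) r j
  rw [heps.pd_pd_eps hU hx, heps.pd_pd_eps hU hx] at h
  linarith
end
end

section
/- Let ε be a splitting on a connected open set U ⊆ ℝⁿ and let ξ : U → ℝⁿ be a smooth vector field. Then ∇_rξ^i = 0 on U for all indices r, i if and only if ξ is ε-parallel. -/
noncomputable section

open Set

section Splitting

variable {n : ℕ} {U : Set (Fin n → ℝ)}
  {eps : (Fin n → ℝ) → (Fin n → ℝ) → Fin n → Fin n → ℝ}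

/-- Two linear maps on `ℝⁿ` that agree on the standard basis vectors are equal. -/
theorem clm_ext_single {f g : (Fin n → ℝ) →L[ℝ] ℝ}
    (h : ∀ j, f (Pi.single j 1) = g (Pi.single j 1)) : f = g := by
  apply ContinuousLinearMap.coe_injective
  refine LinearMap.pi_ext' fun j => LinearMap.ext_ring ?_
  simpa using h j

theorem IsSplitting.differentiableAt (heps : IsSplitting U eps) (hU : IsOpen U)
    {x y : Fin n → ℝ} (hx : x ∈ U) (hy : y ∈ U) (i j : Fin n) :
    DifferentiableAt ℝ (fun p : (Fin n → ℝ) × (Fin n → ℝ) => eps p.1 p.2 i j) (x, y) :=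
  ((heps.smooth i j).contDiffAt ((hU.prod hU).mem_nhds ⟨hx, hy⟩)).differentiableAt (by simp)

theorem IsSplitting.differentiableAt_right (heps : IsSplitting U eps) (hU : IsOpen U)
    {x y : Fin n → ℝ} (hx : x ∈ U) (hy : y ∈ U) (i j : Fin n) :
    DifferentiableAt ℝ (fun y' => eps x y' i j) y :=
  (heps.differentiableAt hU hx hy i j).comp y
    ((differentiableAt_const x).prodMk differentiableAt_id)

/-- On the diagonal, the derivative of a splitting in its first argument is minus the derivative
in its second argument. -/
theorem IsSplitting.hasFDerivAt_left (heps : IsSplitting U eps) (hU : IsOpen U)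
    {p : Fin n → ℝ} (hp : p ∈ U) (i j : Fin n) :
    HasFDerivAt (fun y => eps y p i j) (-fderiv ℝ (fun y => eps p y i j) p) p := by
  have hE := (heps.differentiableAt hU hp hp i j).hasFDerivAt
  set E := fderiv ℝ (fun q : (Fin n → ℝ) × (Fin n → ℝ) => eps q.1 q.2 i j) (p, p)
  have hleft : HasFDerivAt (fun y => eps y p i j) _ p :=
    hE.comp (f := fun y => (y, p)) p ((hasFDerivAt_id p).prodMk (hasFDerivAt_const p p))
  have hright : HasFDerivAt (fun y => eps p y i j) _ p :=
    hE.comp (f := fun y => (p, y)) p ((hasFDerivAt_const p p).prodMk (hasFDerivAt_id p))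
  have hdiag : HasFDerivAt (fun y => eps y y i j) _ p :=
    hE.comp (f := fun y => (y, y)) p ((hasFDerivAt_id p).prodMk (hasFDerivAt_id p))
  have hconst : HasFDerivAt (fun y => eps y y i j) (0 : (Fin n → ℝ) →L[ℝ] ℝ) p :=
    (hasFDerivAt_const (if i = j then (1 : ℝ) else 0) p).congr_of_eventuallyEq <| by
      filter_upwards [hU.mem_nhds hp] with y hy using heps.refl y hy i j
  have hzero := hdiag.unique hconst
  rw [hright.fderiv]
  refine hleft.congr_fderiv ?_
  ext v
  have hv : E (v, v) = 0 := by simpa using congrArg (fun L => L v) hzero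
  have hsplit : E (v, v) = E (v, 0) + E (0, v) := by rw [← map_add]; simp
  simp
  linarith

theorem IsSplitting.sum_refl_mul (heps : IsSplitting U eps) {p : Fin n → ℝ} (hp : p ∈ U)
    (v : Fin n → ℝ) (i : Fin n) : ∑ a, eps p p i a * v a = v i := by
  simp [heps.refl p hp]

/-- An `ε`-parallel vector field is annihilated by the covariant derivative. -/
theorem EpsParallelVF.pd_sub_eq_zero {ξ : (Fin n → ℝ) → Fin n → ℝ}
    (h : EpsParallelVF U eps ξ) (heps : IsSplitting U eps) (hU : IsOpen U)
    {x : Fin n → ℝ} (hx : x ∈ U) (r i : Fin n) :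
    pd r (fun x' => ξ x' i) x - ∑ a, Gam eps i r a x * ξ x a = 0 := by
  have hsum : HasFDerivAt (fun y => ∑ a, eps x y i a * ξ x a)
      (∑ a, ξ x a • fderiv ℝ (fun y => eps x y i a) x) x :=
    HasFDerivAt.fun_sum fun a _ =>
      (heps.differentiableAt_right hU hx hx i a).hasFDerivAt.mul_const (ξ x a)
  have hd : HasFDerivAt (fun y => ξ y i) _ x := hsum.congr_of_eventuallyEq <| by
    filter_upwards [hU.mem_nhds hx] with y hy using h x hx y hy i
  simp [pd, Gam, hd.fderiv, mul_comm]

/-- Transporting a covariantly constant vector field back to `p` is stationary at `p`. -/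
theorem IsSplitting.hasFDerivAt_transport (heps : IsSplitting U eps) (hU : IsOpen U)
    {ξ : (Fin n → ℝ) → Fin n → ℝ} {p : Fin n → ℝ} (hp : p ∈ U)
    (hξ : ∀ i, DifferentiableAt ℝ (fun x => ξ x i) p)
    (h : ∀ r i, pd r (fun x' => ξ x' i) p - ∑ a, Gam eps i r a p * ξ p a = 0) (i : Fin n) :
    HasFDerivAt (fun y => ∑ a, eps y p i a * ξ y a) (0 : (Fin n → ℝ) →L[ℝ] ℝ) p := by
  have hsum : HasFDerivAt (fun y => ∑ a, eps y p i a * ξ y a) _ p :=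
    HasFDerivAt.fun_sum fun a _ => (heps.hasFDerivAt_left hU hp i a).mul (hξ a).hasFDerivAt
  refine hsum.congr_fderiv (clm_ext_single fun r => ?_)
  have hr := h r i
  have hrefl := heps.sum_refl_mul hp (fun a => fderiv ℝ (fun x => ξ x a) p (Pi.single r 1)) i
  simp only [pd, Gam] at hr
  simp only [zero_apply, sum_apply,
    add_apply, smul_apply, neg_apply,
    smul_eq_mul, Finset.sum_add_distrib, hrefl, mul_neg, Finset.sum_neg_distrib]
  rw [← hr, sub_eq_add_neg]
  simp only [mul_comm]

/-- Transporting a covariantly constant vector field to a fixed point has zero derivative. -/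
theorem IsSplitting.hasFDerivAt_transport_to (heps : IsSplitting U eps) (hU : IsOpen U)
    {ξ : (Fin n → ℝ) → Fin n → ℝ} {p q : Fin n → ℝ} (hp : p ∈ U) (hq : q ∈ U)
    (hξ : ∀ i, DifferentiableAt ℝ (fun x => ξ x i) p)
    (h : ∀ r i, pd r (fun x' => ξ x' i) p - ∑ a, Gam eps i r a p * ξ p a = 0) (i : Fin n) :
    HasFDerivAt (fun y => ∑ a, eps y q i a * ξ y a) (0 : (Fin n → ℝ) →L[ℝ] ℝ) p := by
  have hsum : HasFDerivAt (fun y => ∑ b, eps p q i b * ∑ a, eps y p b a * ξ y a)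
      (∑ b, eps p q i b • (0 : (Fin n → ℝ) →L[ℝ] ℝ)) p :=
    HasFDerivAt.fun_sum fun b _ => (heps.hasFDerivAt_transport hU hp hξ h b).const_mul _
  simp only [smul_zero, Finset.sum_const_zero] at hsum
  refine hsum.congr_of_eventuallyEq ?_
  filter_upwards [hU.mem_nhds hp] with y hy
  simp only [← heps.comp y hy q hq p hp, Finset.sum_mul, Finset.mul_sum]
  rw [Finset.sum_comm]
  simp only [mul_assoc]

end Splitting

/-- A smooth vector field `ξ` on connected open `U` satisfies
`∇_r ξ^i = ∂ξ^i/∂x^r − Γ^i_{ra} ξ^a = 0` iff `ξ` is `ε`-parallel. -/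
theorem stmt_4 {n : ℕ} (hn : 2 ≤ n) (U : Set (Fin n → ℝ)) (hU : IsOpen U)
    (hUconn : IsConnected U)
    (eps : (Fin n → ℝ) → (Fin n → ℝ) → Fin n → Fin n → ℝ) (heps : IsSplitting U eps)
    (ξ : (Fin n → ℝ) → Fin n → ℝ)
    (hξ : ∀ i : Fin n, ContDiffOn ℝ (⊤ : ℕ∞) (fun x => ξ x i) U) :
    (∀ x ∈ U, ∀ r i : Fin n,
        pd r (fun x' => ξ x' i) x - ∑ a, Gam eps i r a x * ξ x a = 0) ↔
      EpsParallelVF U eps ξ := by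
  refine ⟨fun h x hx y hy i => ?_, fun h x hx r i => h.pd_sub_eq_zero heps hU hx r i⟩
  have hd : ∀ p ∈ U, HasFDerivAt (fun z => ∑ a, eps z y i a * ξ z a)
      (0 : (Fin n → ℝ) →L[ℝ] ℝ) p := fun p hp =>
    heps.hasFDerivAt_transport_to hU hp hy
      (fun j => ((hξ j).contDiffAt (hU.mem_nhds hp)).differentiableAt (by simp)) (h p hp) i
  have hconst := hU.is_const_of_fderiv_eq_zero hUconn.isPreconnected
    (fun p hp => (hd p hp).differentiableAt.differentiableWithinAt)
    (fun p hp => (hd p hp).fderiv) hy hx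
  simpa only [heps.sum_refl_mul hy] using hconst
end
end
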